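/- There exists an infinite, finitely generated group G that acts sharply 2-transitively on some set X. -/

import Mathlib

/-- An involution of a group is an element of order 2. -/
def IsInvolution {G : Type*} [Monoid G] (g : G) : Prop := orderOf g = 2

/-- A group `G` acts sharply 2-transitively on `X` if `X` has at least two elements and
any pair of distinct points of `X` is sent to any other such pair by a unique element of `G`. -/
def SharplyTwoTransitive (G X : Type*) [Group G] [MulAction G X] : Prop :=
  Nontrivial X ∧ ∀ x₁ x₂ y₁ y₂ : X, x₁ ≠ x₂ → y₁ ≠ y₂ →
    ∃! g : G, g • x₁ = y₁ ∧ g • x₂ = y₂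

/-! Construction: let `C = ℤ × ℤ/2`, and `K = C * ℤ`.  We build a permutation `d` of `C` such that
`K` (acting by translations and `d`) is sharply 2-transitive on `C`.  The orbits of `C` on pairs of
distinct points are indexed by differences; `d` is built by finite approximations such that the
graph of differences is a forest, which is witnessed by an equivariant map to `K`. -/

namespace SharpTwo

abbrev C : Type := ℤ × ZMod 2

def tt : C := (0, 1)

lemma self_neg_iff (u : C) (h : u = -u) : u = 0 ∨ u = tt := by
  obtain ⟨a, b⟩ := u
  have h1 : a = -a := congrArg Prod.fst h
  have ha : a = 0 := by omega
  subst ha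
  fin_cases b
  · left; rfl
  · right; rfl

lemma neg_tt : -tt = tt := by decide

lemma tt_ne : tt ≠ 0 := by decide

set_option linter.unusedSectionVars false

section stage

variable {K : Type} [Group K]

/-- `f, ρ` satisfy the edge constraints `E`, with support in `S`, soundly with respect to `R`. -/
structure Good (E : Set (C × C × K)) (R : C → C → Prop) (S : Set C) (f : C → K) (ρ : C → C) :
    Prop where
  odd : ∀ v, ρ (-v) = -ρ v
  nz : ∀ v, v ≠ 0 → ρ v ≠ 0
  sat : ∀ a b k, (a, b, k) ∈ E → ρ a = ρ b ∧ f b = k * f a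
  supp : ∀ v, v ∉ S → ρ v = v
  img : ∀ v, v ∈ S → ρ v ∈ S
  negS : ∀ v, v ∈ S → -v ∈ S
  sound : ∀ v, R v (ρ v)

/-- later stages keep the data on the main component -/
def Ext (f : C → K) (ρ : C → C) (f' : C → K) (ρ' : C → C) : Prop :=
  ∀ v, ρ v = tt → ρ' v = tt ∧ f' v = f v

lemma Ext.refl (f : C → K) (ρ : C → C) : Ext f ρ f ρ := fun _ h => ⟨h, rfl⟩

lemma Ext.trans {f₁ f₂ f₃ : C → K} {ρ₁ ρ₂ ρ₃ : C → C} (h : Ext f₁ ρ₁ f₂ ρ₂)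
    (h' : Ext f₂ ρ₂ f₃ ρ₃) : Ext f₁ ρ₁ f₃ ρ₃ := fun v hv =>
  ⟨(h' v (h v hv).1).1, (h' v (h v hv).1).2.trans (h v hv).2⟩

lemma Good.rho_tt {E : Set (C × C × K)} {R S f ρ} (h : Good E R S f ρ) : ρ tt = tt := by
  have h1 := h.odd tt
  rw [neg_tt] at h1
  exact (self_neg_iff _ h1).resolve_left (h.nz _ tt_ne)

/-- four-element symmetric set -/
def four (a b : C) : Set C := {v | v = a ∨ v = -a ∨ v = b ∨ v = -b}

lemma step_aux {E : Set (C × C × K)} {R S f ρ} (h : Good E R S f ρ) (hR : Equivalence R)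
    (a b : C) (k k' : K) (ha : a ≠ 0) (hb0 : b ≠ 0) (hat : ρ a ≠ tt)
    (h1 : ρ b ≠ ρ a) (h2 : ρ b ≠ -ρ a) (r1 : R a b) (r2 : R (-a) (-b)) :
    ∃ f' ρ', Good (E ∪ {(a, b, k), (-a, -b, k')}) R (S ∪ four a b) f' ρ' ∧ Ext f ρ f' ρ' := by
  classical
  have hna : ρ a ≠ -ρ a := fun e => (self_neg_iff _ e).elim (h.nz a ha) hat
  have hnt : -ρ a ≠ tt := fun e => hat (by rw [← neg_neg (ρ a), e, neg_tt])
  have h3 : -ρ b ≠ ρ a := fun e => h2 (by rw [← e, neg_neg])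
  have h4 : -ρ b ≠ -ρ a := fun e => h1 (neg_injective e)
  have memS : ∀ v, ρ v ∈ S ∨ ρ v = v := fun v => by
    by_cases hv : v ∈ S
    · exact Or.inl (h.img v hv)
    · exact Or.inr (h.supp v hv)
  refine ⟨fun v => if ρ v = ρ a then f v * ((f a)⁻¹ * k⁻¹ * f b)
      else if ρ v = -ρ a then f v * ((f (-a))⁻¹ * k'⁻¹ * f (-b)) else f v,
    fun v => if ρ v = ρ a then ρ b else if ρ v = -ρ a then -ρ b else ρ v, ?_, ?_⟩
  · constructor
    · intro v
      simp only [h.odd]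
      by_cases e1 : ρ v = ρ a
      · simp [e1, hna.symm]
      · by_cases e2 : ρ v = -ρ a
        · simp [e2, hna.symm]
        · have e3 : -ρ v ≠ ρ a := fun e => e2 (by rw [← e, neg_neg])
          have e4 : -ρ v ≠ -ρ a := fun e => e1 (neg_injective e)
          simp [e1, e2, e3]
    · intro v hv
      have hb : ρ b ≠ 0 := h.nz b hb0
      split_ifs
      · exact hb
      · exact neg_ne_zero.mpr hb
      · exact h.nz v hv
    · intro a' b' l hl
      rcases hl with hl | hl | hl
      · obtain ⟨q1, q2⟩ := h.sat a' b' l hl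
        rw [q1, q2]
        refine ⟨rfl, ?_⟩
        split_ifs <;> group
      · simp only [Prod.mk.injEq] at hl
        obtain ⟨rfl, rfl, rfl⟩ := hl
        simp [h1, h2, mul_assoc]
      · simp only [Prod.mk.injEq, Set.mem_singleton_iff] at hl
        obtain ⟨rfl, rfl, rfl⟩ := hl
        simp only [h.odd]
        simp [hna.symm, h3, h1, mul_assoc]
    · intro v hv
      simp only [Set.mem_union, four, Set.mem_ofPred_eq, not_or] at hv
      obtain ⟨hv, n1, n2, n3, n4⟩ := hv
      have e := h.supp v hv
      have e1 : v ≠ ρ a := by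
        intro e1
        rcases memS a with m | m
        · exact hv (e1 ▸ m)
        · exact n1 (e1.trans m)
      have e2 : v ≠ -ρ a := by
        intro e1
        rcases memS a with m | m
        · exact hv (e1 ▸ h.negS _ m)
        · exact n2 (by rw [e1, m])
      simp [e, e1, e2]
    · intro v hv
      have hb : ρ b ∈ S ∪ four a b := by
        rcases memS b with m | m
        · exact Or.inl m
        · rw [m]; right; simp [four]
      have hb' : -ρ b ∈ S ∪ four a b := by
        rcases memS b with m | m
        · exact Or.inl (h.negS _ m)
        · rw [m]; right; simp [four]
      split_ifs
      · exact hb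
      · exact hb'
      · rcases memS v with m | m
        · exact Or.inl m
        · rw [m]; exact hv
    · rintro v (hv | hv)
      · exact Or.inl (h.negS _ hv)
      · right
        rcases hv with rfl | rfl | rfl | rfl <;> simp [four]
    · intro v
      have sv := h.sound v
      split_ifs with e1 e2
      · rw [e1] at sv
        exact hR.trans sv (hR.trans (hR.symm (h.sound a)) (hR.trans r1 (h.sound b)))
      · rw [e2] at sv
        have sa := h.sound (-a)
        have sb := h.sound (-b)
        rw [h.odd] at sa sb
        exact hR.trans sv (hR.trans (hR.symm sa) (hR.trans r2 sb))
      · exact sv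
  · intro v hv
    simp [hv, hat.symm, hnt.symm]


lemma four_comm (a b : C) : four a b = four b a := by
  ext v
  simp only [four, Set.mem_ofPred_eq]
  tauto

lemma Good.mono {E E' : Set (C × C × K)} {R S f ρ} (h : Good E R S f ρ)
    (hE : ∀ a b k, (a, b, k) ∈ E' → (a, b, k) ∈ E ∨ (b, a, k⁻¹) ∈ E) : Good E' R S f ρ := by
  refine ⟨h.odd, h.nz, ?_, h.supp, h.img, h.negS, h.sound⟩
  intro a b k hk
  rcases hE a b k hk with hk | hk
  · exact h.sat a b k hk
  · obtain ⟨q1, q2⟩ := h.sat _ _ _ hk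
    exact ⟨q1.symm, by rw [q2]; group⟩

lemma Good.monoR {E : Set (C × C × K)} {R R' : C → C → Prop} {S f ρ} (h : Good E R S f ρ)
    (hR : ∀ a b, R a b → R' a b) : Good E R' S f ρ :=
  ⟨h.odd, h.nz, h.sat, h.supp, h.img, h.negS, fun v => hR _ _ (h.sound v)⟩

lemma step {E : Set (C × C × K)} {R S f ρ} (h : Good E R S f ρ) (hR : Equivalence R)
    (a b : C) (k k' : K) (ha : a ≠ 0) (hb : b ≠ 0)
    (h1 : ρ b ≠ ρ a) (h2 : ρ b ≠ -ρ a) (r1 : R a b) (r2 : R (-a) (-b)) :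
    ∃ f' ρ', Good (E ∪ {(a, b, k), (-a, -b, k')}) R (S ∪ four a b) f' ρ' ∧ Ext f ρ f' ρ' := by
  by_cases hat : ρ a = tt
  · obtain ⟨f', ρ', g, e⟩ := step_aux h hR b a k⁻¹ k'⁻¹ hb ha (fun e => h1 (e.trans hat.symm))
      h1.symm (fun e => h2 (by rw [e, neg_neg])) (hR.symm r1) (hR.symm r2)
    refine ⟨f', ρ', ?_, e⟩
    rw [four_comm]
    refine g.mono ?_
    rintro a' b' l (hl | hl | hl)
    · exact Or.inl (Or.inl hl)
    · simp only [Prod.mk.injEq] at hl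
      obtain ⟨rfl, rfl, rfl⟩ := hl
      right; right; left; rfl
    · simp only [Prod.mk.injEq, Set.mem_singleton_iff] at hl
      obtain ⟨rfl, rfl, rfl⟩ := hl
      right; right; right; rfl
  · exact step_aux h hR a b k k' ha hb hat h1 h2 r1 r2

lemma leaves {ι : Type} [DecidableEq ι] {E : Set (C × C × K)} {R S f ρ}
    (h : Good E R S f ρ) (hR : Equivalence R) (a b : ι → C) (k k' : ι → K) (s : Finset ι)
    (ha : ∀ i ∈ s, a i ≠ 0) (hb : ∀ i ∈ s, b i ≠ 0) (hbS : ∀ i ∈ s, b i ∉ S)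
    (r1 : ∀ i ∈ s, R (a i) (b i)) (r2 : ∀ i ∈ s, R (-a i) (-b i))
    (hbb : ∀ i ∈ s, ∀ j ∈ s, i ≠ j → b i ≠ b j) (hbb' : ∀ i ∈ s, ∀ j ∈ s, b i ≠ -b j)
    (hab : ∀ i ∈ s, ∀ j ∈ s, b i ≠ a j) (hab' : ∀ i ∈ s, ∀ j ∈ s, b i ≠ -a j) :
    ∃ f' ρ', Good (E ∪ {e | ∃ i ∈ s, e = (a i, b i, k i) ∨ e = (-a i, -b i, k' i)}) R
      (S ∪ {v | ∃ i ∈ s, v ∈ four (a i) (b i)}) f' ρ' ∧ Ext f ρ f' ρ' := by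
  induction s using Finset.induction_on with
  | empty => exact ⟨f, ρ, by simpa using h, Ext.refl f ρ⟩
  | insert i s hi ih =>
    have sub : ∀ j, j ∈ s → j ∈ insert i s := fun j hj => Finset.mem_insert_of_mem hj
    have mi : i ∈ insert i s := Finset.mem_insert_self i s
    obtain ⟨f₁, ρ₁, g, e⟩ := ih (fun j hj => ha j (sub j hj)) (fun j hj => hb j (sub j hj))
      (fun j hj => hbS j (sub j hj)) (fun j hj => r1 j (sub j hj)) (fun j hj => r2 j (sub j hj))
      (fun j hj l hl => hbb j (sub j hj) l (sub l hl))
      (fun j hj l hl => hbb' j (sub j hj) l (sub l hl))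
      (fun j hj l hl => hab j (sub j hj) l (sub l hl))
      (fun j hj l hl => hab' j (sub j hj) l (sub l hl))
    have hf : b i ∉ S ∪ {v | ∃ i ∈ s, v ∈ four (a i) (b i)} := by
      rintro (m | ⟨j, hj, m | m | m | m⟩)
      · exact hbS i mi m
      · exact hab i mi j (sub j hj) m
      · exact hab' i mi j (sub j hj) m
      · exact hbb i mi j (sub j hj) (fun e => hi (e ▸ hj)) m
      · exact hbb' i mi j (sub j hj) m
    have hρb := g.supp _ hf
    have key : ρ₁ (a i) ≠ b i ∧ ρ₁ (a i) ≠ - b i := by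
      by_cases m : a i ∈ S ∪ {v | ∃ i ∈ s, v ∈ four (a i) (b i)}
      · have m' := g.img _ m
        exact ⟨fun e => hf (e ▸ m'), fun e => hf (by
          have := g.negS _ m'
          rwa [e, neg_neg] at this)⟩
      · rw [g.supp _ m]
        exact ⟨(hab i mi i mi).symm, fun e => hab' i mi i mi (by rw [e, neg_neg])⟩
    obtain ⟨f₂, ρ₂, g2, e2⟩ := step g hR (a i) (b i) (k i) (k' i) (ha i mi) (hb i mi)
      (by rw [hρb]; exact key.1.symm)
      (by rw [hρb]; exact fun e => key.2 (by rw [e, neg_neg])) (r1 i mi) (r2 i mi)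
    refine ⟨f₂, ρ₂, ?_, e.trans e2⟩
    have hS : S ∪ {v | ∃ j ∈ insert i s, v ∈ four (a j) (b j)} =
        S ∪ {v | ∃ i ∈ s, v ∈ four (a i) (b i)} ∪ four (a i) (b i) := by
      ext v
      constructor
      · rintro (hv | ⟨j, hj, hv⟩)
        · exact Or.inl (Or.inl hv)
        · rcases Finset.mem_insert.1 hj with rfl | hj
          · exact Or.inr hv
          · exact Or.inl (Or.inr ⟨j, hj, hv⟩)
      · rintro ((hv | ⟨j, hj, hv⟩) | hv)
        · exact Or.inl hv
        · exact Or.inr ⟨j, sub j hj, hv⟩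
        · exact Or.inr ⟨i, mi, hv⟩
    rw [hS]
    refine g2.mono ?_
    rintro a' b' l (hl | ⟨j, hj, hl⟩)
    · exact Or.inl (Or.inl (Or.inl hl))
    · rcases Finset.mem_insert.1 hj with rfl | hj
      · exact Or.inl (Or.inr hl)
      · exact Or.inl (Or.inl (Or.inr ⟨j, hj, hl⟩))

/-- the edges of a partial permutation -/
def ED (τ : C → K) (δ : K) (D : Finset (C × C)) : Set (C × C × K) :=
  {e | ∃ p ∈ D, ∃ q ∈ D, p ≠ q ∧ e = (q.1 - p.1, q.2 - p.2, (τ p.2)⁻¹ * δ * τ p.1)}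

def Conn (D : Finset (C × C)) : C → C → Prop :=
  Relation.EqvGen (fun a b => ∃ p ∈ D, ∃ q ∈ D, a = q.1 - p.1 ∧ b = q.2 - p.2)

lemma Conn.equiv (D : Finset (C × C)) : Equivalence (Conn D) := Relation.EqvGen.is_equivalence _

lemma Conn.mono {D D' : Finset (C × C)} (h : D ⊆ D') (a b : C) (hc : Conn D a b) : Conn D' a b :=
  Relation.EqvGen.mono (fun _ _ ⟨p, hp, q, hq, e⟩ => ⟨p, h hp, q, h hq, e⟩) a b hc

lemma addPair {τ : C → K} {δ : K} {E : Set (C × C × K)} {S f ρ} (D D1 : Finset (C × C)) (x w : C)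
    (hD : D1 ⊆ D) (h : Good E (Conn (insert (x, w) D)) S f ρ) (hE : ED τ δ D ⊆ E)
    (hx : ∀ p ∈ D, p.1 ≠ x) (hw : ∀ p ∈ D, p.2 ≠ w)
    (injR : ∀ p ∈ D, ∀ q ∈ D, p.2 = q.2 → p = q)
    (hex : ∀ y ∈ D, y ∉ D1 → (y.1 - x, y.2 - w, (τ w)⁻¹ * δ * τ x) ∈ E ∧
      (x - y.1, w - y.2, (τ y.2)⁻¹ * δ * τ y.1) ∈ E)
    (fr1 : ∀ y ∈ D1, y.2 - w ∉ S) (fr2 : ∀ y ∈ D1, ∀ z ∈ D1, y.2 - w ≠ -(z.2 - w))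
    (fr3 : ∀ y ∈ D1, ∀ z ∈ D1, y.2 - w ≠ z.1 - x)
    (fr4 : ∀ y ∈ D1, ∀ z ∈ D1, y.2 - w ≠ -(z.1 - x)) :
    ∃ f' ρ', Good (ED τ δ (insert (x, w) D)) (Conn (insert (x, w) D))
      (S ∪ {v | ∃ i ∈ D1, v ∈ four (i.1 - x) (i.2 - w)}) f' ρ' ∧ Ext f ρ f' ρ' := by
  have m0 : (x, w) ∈ insert (x, w) D := Finset.mem_insert_self _ _
  have m1 : ∀ i ∈ D1, i ∈ insert (x, w) D := fun i hi => Finset.mem_insert_of_mem (hD hi)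
  obtain ⟨f', ρ', g, e⟩ := leaves h (Conn.equiv _) (fun i : C × C => i.1 - x) (fun i => i.2 - w)
    (fun _ => (τ w)⁻¹ * δ * τ x) (fun y => (τ y.2)⁻¹ * δ * τ y.1) D1
    (fun i hi => sub_ne_zero.2 (hx i (hD hi))) (fun i hi => sub_ne_zero.2 (hw i (hD hi)))
    fr1
    (fun i hi => Relation.EqvGen.rel _ _ ⟨(x, w), m0, i, m1 i hi, rfl, rfl⟩)
    (fun i hi => Relation.EqvGen.rel _ _ ⟨i, m1 i hi, (x, w), m0, by simp, by simp⟩)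
    (fun i hi j hj hij e => hij (injR i (hD hi) j (hD hj) (sub_left_injective e)))
    fr2 fr3 fr4
  refine ⟨f', ρ', g.mono ?_, e⟩
  rintro a b k ⟨p, hp, q, hq, hpq, he⟩
  left
  rw [he]
  rcases Finset.mem_insert.1 hp with rfl | hp <;> rcases Finset.mem_insert.1 hq with rfl | hq
  · exact absurd rfl hpq
  · by_cases hq1 : q ∈ D1
    · exact Or.inr ⟨q, hq1, Or.inl rfl⟩
    · exact Or.inl (hex q hq hq1).1
  · by_cases hq1 : p ∈ D1
    · exact Or.inr ⟨p, hq1, Or.inr (by simp)⟩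
    · exact Or.inl (hex p hp hq1).2
  · exact Or.inl (hE ⟨p, hp, q, hq, hpq, rfl⟩)

structure Stage (τ : C → K) (δ : K) (D : Finset (C × C)) (S : Set C) (f : C → K) (ρ : C → C)
    (M : ℤ) : Prop where
  bS : ∀ v ∈ S, |v.1| ≤ M
  bD : ∀ p ∈ D, |p.1.1| ≤ M ∧ |p.2.1| ≤ M
  injL : ∀ p ∈ D, ∀ q ∈ D, p.1 = q.1 → p = q
  injR : ∀ p ∈ D, ∀ q ∈ D, p.2 = q.2 → p = q
  good : Good (ED τ δ D) (Conn D) S f ρ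

lemma inj_insert {A B : Type} [DecidableEq (A × B)] {D : Finset (A × B)} {x : A} {w : B}
    (hx : ∀ p ∈ D, p.1 ≠ x) (h : ∀ p ∈ D, ∀ q ∈ D, p.1 = q.1 → p = q) :
    ∀ p ∈ insert (x, w) D, ∀ q ∈ insert (x, w) D, p.1 = q.1 → p = q := by
  intro p hp q hq e
  rcases Finset.mem_insert.1 hp with rfl | hp <;> rcases Finset.mem_insert.1 hq with rfl | hq
  · rfl
  · exact absurd e.symm (hx q hq)
  · exact absurd e (hx p hp)
  · exact h p hp q hq e

lemma inj_insert' {A B : Type} [DecidableEq (A × B)] {D : Finset (A × B)} {x : A} {w : B}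
    (hx : ∀ p ∈ D, p.2 ≠ w) (h : ∀ p ∈ D, ∀ q ∈ D, p.2 = q.2 → p = q) :
    ∀ p ∈ insert (x, w) D, ∀ q ∈ insert (x, w) D, p.2 = q.2 → p = q := by
  intro p hp q hq e
  rcases Finset.mem_insert.1 hp with rfl | hp <;> rcases Finset.mem_insert.1 hq with rfl | hq
  · rfl
  · exact absurd e.symm (hx q hq)
  · exact absurd e (hx p hp)
  · exact h p hp q hq e

lemma fst_ne {u v : C} (h : u.1 ≠ v.1) : u ≠ v := fun e => h (congrArg Prod.fst e)

lemma extL {τ : C → K} {δ : K} {D S f ρ M} (h : Stage τ δ D S f ρ M) (x : C)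
    (hx : ∀ p ∈ D, p.1 ≠ x) (N : ℤ) :
    ∃ w f' ρ' M', N < w.1 ∧ Stage τ δ (insert (x, w) D)
      (S ∪ {v | ∃ i ∈ D, v ∈ four (i.1 - x) (i.2 - w)}) f' ρ' M' ∧ Ext f ρ f' ρ' := by
  obtain ⟨n, hn⟩ : ∃ n : ℤ, n = |N| + 10 * (|M| + |x.1|) + 10 := ⟨_, rfl⟩
  have a1 := abs_nonneg M
  have a2 := abs_nonneg N
  have a3 := le_abs_self M
  have a4 := le_abs_self N
  have a5 := abs_nonneg x.1
  have a6 := le_abs_self x.1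
  have a7 := neg_abs_le x.1
  have hD1 : ∀ p ∈ D, -|M| ≤ p.1.1 ∧ p.1.1 ≤ |M| ∧ -|M| ≤ p.2.1 ∧ p.2.1 ≤ |M| := by
    intro p hp
    have := h.bD p hp
    have b1 := abs_le.1 this.1
    have b2 := abs_le.1 this.2
    omega
  have hw : ∀ p ∈ D, p.2 ≠ ((n, 0) : C) := fun p hp => fst_ne (by
    have := hD1 p hp
    simp only; omega)
  obtain ⟨f', ρ', g, e⟩ := addPair (τ := τ) (δ := δ) D D x (n, 0) subset_rfl
    (h.good.monoR (Conn.mono (Finset.subset_insert _ _))) subset_rfl hx hw h.injR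
    (fun y hy hy' => absurd hy hy')
    (fun y hy m => by
      have := hD1 y hy
      have b := abs_le.1 (h.bS _ m)
      simp only [Prod.fst_sub] at b
      omega)
    (fun y hy z hz => fst_ne (by
      have := hD1 y hy
      have := hD1 z hz
      simp only [Prod.fst_sub, Prod.fst_neg]
      omega))
    (fun y hy z hz => fst_ne (by
      have := hD1 y hy
      have := hD1 z hz
      simp only [Prod.fst_sub]
      omega))
    (fun y hy z hz => fst_ne (by
      have := hD1 y hy
      have := hD1 z hz
      simp only [Prod.fst_sub, Prod.fst_neg]
      omega))
  refine ⟨(n, 0), f', ρ', 2 * n, by simp only; omega, ?_, e⟩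
  refine ⟨?_, ?_, inj_insert hx h.injL, inj_insert' hw h.injR, g⟩
  · rintro v (hv | ⟨i, hi, hv⟩)
    · have := h.bS v hv
      omega
    · have := hD1 i hi
      rw [abs_le]
      rcases hv with rfl | rfl | rfl | rfl <;> simp only [Prod.fst_sub, Prod.fst_neg] <;> omega
  · intro p hp
    rw [abs_le, abs_le]
    rcases Finset.mem_insert.1 hp with rfl | hp
    · simp only; omega
    · have := hD1 p hp
      omega

lemma Stage.swap {τ : C → K} {δ : K} {D S f ρ M} (h : Stage τ δ D S f ρ M) :
    Stage τ δ⁻¹ (D.image Prod.swap) S f ρ M := by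
  have key : ∀ p, p ∈ D.image Prod.swap ↔ p.swap ∈ D := by
    intro p
    simp only [Finset.mem_image]
    exact ⟨fun ⟨q, hq, e⟩ => by rw [← e, Prod.swap_swap]; exact hq,
      fun hp => ⟨p.swap, hp, Prod.swap_swap p⟩⟩
  refine ⟨h.bS, ?_, ?_, ?_, ?_⟩
  · intro p hp
    exact (h.bD _ ((key p).1 hp)).symm
  · intro p hp q hq e
    exact Prod.swap_injective (h.injR _ ((key p).1 hp) _ ((key q).1 hq) e)
  · intro p hp q hq e
    exact Prod.swap_injective (h.injL _ ((key p).1 hp) _ ((key q).1 hq) e)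
  · refine (h.good.monoR ?_).mono ?_
    · intro a b hab
      induction hab with
      | rel a b hab =>
        obtain ⟨p, hp, q, hq, rfl, rfl⟩ := hab
        exact (Conn.equiv _).symm (Relation.EqvGen.rel _ _
          ⟨p.swap, (key _).2 (by simpa using hp), q.swap, (key _).2 (by simpa using hq), rfl, rfl⟩)
      | refl a => exact (Conn.equiv _).refl a
      | symm a b _ ih => exact (Conn.equiv _).symm ih
      | trans a b c _ _ ih1 ih2 => exact (Conn.equiv _).trans ih1 ih2
    · rintro a b k ⟨p, hp, q, hq, hpq, he⟩
      simp only [Prod.mk.injEq] at he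
      obtain ⟨rfl, rfl, rfl⟩ := he
      right
      exact ⟨p.swap, (key p).1 hp, q.swap, (key q).1 hq, fun e => hpq (Prod.swap_injective e), by
        simp [mul_assoc]⟩

lemma extR {τ : C → K} {δ : K} {D S f ρ M} (h : Stage τ δ D S f ρ M) (w : C)
    (hw : ∀ p ∈ D, p.2 ≠ w) (N : ℤ) :
    ∃ x S' f' ρ' M', N < x.1 ∧ Stage τ δ (insert (x, w) D) S' f' ρ' M' ∧ Ext f ρ f' ρ' := by
  obtain ⟨x, f', ρ', M', hx, st, e⟩ := extL h.swap w (by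
    intro p hp
    obtain ⟨q, hq, rfl⟩ := Finset.mem_image.1 hp
    exact hw q hq) N
  have st' := st.swap
  rw [inv_inv, Finset.image_insert, Finset.image_image, Prod.swap_swap_eq, Finset.image_id,
    Prod.swap_prod_mk] at st'
  exact ⟨x, _, f', ρ', M', hx, st', e⟩


lemma extC {τ : C → K} {δ : K} {D S f ρ M} (h : Stage τ δ D S f ρ M) (γ : C) (hγ : γ ≠ 0) :
    ∃ D' S' f' ρ' M', D ⊆ D' ∧ Stage τ δ D' S' f' ρ' M' ∧ Ext f ρ f' ρ' ∧ ρ' γ = tt := by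
  -- first create a fresh difference `v` in the domain, mapped to the difference `tt`
  obtain ⟨m, hm⟩ : ∃ m : ℤ, m = |M| := ⟨_, rfl⟩
  have m0 : 0 ≤ m := hm ▸ abs_nonneg M
  have m1 : M ≤ m := hm ▸ le_abs_self M
  have tt1 : tt.1 = 0 := rfl
  have hD1 : ∀ p ∈ D, -m ≤ p.2.1 ∧ p.2.1 ≤ m := by
    intro p hp
    have b2 := abs_le.1 (h.bD p hp).2
    omega
  obtain ⟨w₀, hw₀⟩ : ∃ w₀ : C, w₀.1 = m + 1 := ⟨(m + 1, 0), rfl⟩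
  obtain ⟨x₁, S₁, f₁, ρ₁, M₁, -, st₁, e₁⟩ := extR h w₀ (fun p hp => fst_ne (by
    have := hD1 p hp
    omega)) 0
  obtain ⟨x₂, S₂, f₂, ρ₂, M₂, hx₂, st₂, e₂⟩ := extR st₁ (w₀ + tt) (by
    intro p hp
    rcases Finset.mem_insert.1 hp with rfl | hp
    · intro e
      exact tt_ne (by simpa using e)
    · have := hD1 p hp
      exact fst_ne (by simp only [Prod.fst_add]; omega)) (|x₁.1| + 4 * m + 10)
  obtain ⟨D₂, hD₂⟩ : ∃ D₂, D₂ = insert (x₂, w₀ + tt) (insert (x₁, w₀) D) := ⟨_, rfl⟩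
  rw [← hD₂] at st₂
  have sub₂ : D ⊆ D₂ := by
    rw [hD₂]
    exact (Finset.subset_insert _ _).trans (Finset.subset_insert _ _)
  obtain ⟨v, hv⟩ : ∃ v, v = x₂ - x₁ := ⟨_, rfl⟩
  have v1 : v.1 = x₂.1 - x₁.1 := by rw [hv]; rfl
  have v2 : 4 * m + 10 < v.1 := by
    have := le_abs_self x₁.1
    omega
  have v0 : v ≠ 0 := fst_ne (by
    have : (0 : C).1 = 0 := rfl
    omega)
  have hρv : ρ₂ v = tt := by
    have hs := st₂.good.sat v tt ((τ w₀)⁻¹ * δ * τ x₁) ⟨(x₁, w₀), by rw [hD₂]; simp,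
      (x₂, w₀ + tt), by rw [hD₂]; simp, fun e => tt_ne (by simpa using (congrArg Prod.snd e).symm),
      by simp [hv]⟩
    rw [hs.1, st₂.good.rho_tt]
  have ran₂ : ∀ p ∈ D₂, -(m + 1) ≤ p.2.1 ∧ p.2.1 ≤ m + 1 := by
    intro p hp
    rw [hD₂] at hp
    rcases Finset.mem_insert.1 hp with rfl | hp
    · simp only [Prod.fst_add]; omega
    · rcases Finset.mem_insert.1 hp with rfl | hp
      · simp only; omega
      · have := hD1 p hp
        omega
  have e02 := e₁.trans e₂
  clear e₁ e₂ hx₂ hD₂ st₁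
  by_cases c₂ : ρ₂ γ = tt
  · exact ⟨D₂, S₂, f₂, ρ₂, M₂, sub₂, st₂, e02, c₂⟩
  obtain ⟨L, hL⟩ : ∃ L : ℤ, L = |M₂| + |γ.1| + v.1 := ⟨_, rfl⟩
  have l1 := abs_nonneg M₂
  have l2 := abs_nonneg γ.1
  have l3 := le_abs_self M₂
  have l4 := le_abs_self γ.1
  have l5 := neg_abs_le γ.1
  obtain ⟨x, hx⟩ : ∃ x : C, x.1 = 4 * L + 1 := ⟨(4 * L + 1, 0), rfl⟩
  have bd₂ : ∀ p ∈ D₂, -L ≤ p.1.1 ∧ p.1.1 ≤ L ∧ -L ≤ p.2.1 ∧ p.2.1 ≤ L := by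
    intro p hp
    have b1 := abs_le.1 (st₂.bD p hp).1
    have b2 := abs_le.1 (st₂.bD p hp).2
    omega
  obtain ⟨w, f₃, ρ₃, M₃, hw, st₃, e₃⟩ := extL st₂ x (fun p hp => fst_ne (by
    have := bd₂ p hp
    omega)) (20 * L + 20)
  have e03 := e02.trans e₃
  by_cases c₃ : ρ₃ γ = tt
  · exact ⟨_, _, f₃, ρ₃, M₃, sub₂.trans (Finset.subset_insert _ _), st₃, e03, c₃⟩
  have hρv₃ : ρ₃ v = tt := (e₃ v hρv).1
  have s34 : insert (x, w) D₂ ⊆ insert (x + γ, w + v) (insert (x, w) D₂) :=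
    Finset.subset_insert _ _
  have mA : (x, w) ∈ insert (x + γ, w + v) (insert (x, w) D₂) := by simp
  have mB : (x + γ, w + v) ∈ insert (x + γ, w + v) (insert (x, w) D₂) := by simp
  obtain ⟨f₄, ρ₄, g₄, e₄⟩ := step (st₃.good.monoR (Conn.mono s34)) (Conn.equiv _) (-γ) (-v)
    ((τ (w + v))⁻¹ * δ * τ (x + γ)) ((τ w)⁻¹ * δ * τ x) (neg_ne_zero.2 hγ) (neg_ne_zero.2 v0)
    (by
      rw [st₃.good.odd, st₃.good.odd, hρv₃]
      exact fun e => c₃ (neg_injective e).symm)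
    (by
      rw [st₃.good.odd, st₃.good.odd, hρv₃, neg_neg, neg_tt]
      exact fun e => c₃ e.symm)
    (Relation.EqvGen.rel _ _ ⟨_, mB, _, mA, by simp, by simp⟩)
    (Relation.EqvGen.rel _ _ ⟨_, mA, _, mB, by simp, by simp⟩)
  have hx' : ∀ p ∈ insert (x, w) D₂, p.1 ≠ x + γ := by
    intro p hp
    rcases Finset.mem_insert.1 hp with rfl | hp
    · intro e
      exact hγ (by simpa using e)
    · have := bd₂ p hp
      exact fst_ne (by simp only [Prod.fst_add]; omega)
  have hw' : ∀ p ∈ insert (x, w) D₂, p.2 ≠ w + v := by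
    intro p hp
    rcases Finset.mem_insert.1 hp with rfl | hp
    · intro e
      exact v0 (by simpa using e)
    · have := bd₂ p hp
      exact fst_ne (by simp only [Prod.fst_add]; omega)
  obtain ⟨f₅, ρ₅, g₅, e₅⟩ := addPair (τ := τ) (δ := δ) (insert (x, w) D₂) D₂ (x + γ) (w + v)
    (Finset.subset_insert _ _) g₄ Set.subset_union_left hx' hw' st₃.injR
    (by
      intro y hy hy'
      obtain rfl : y = (x, w) := (Finset.mem_insert.1 hy).resolve_right hy'
      refine ⟨Or.inr (Or.inl ?_), Or.inr (Or.inr ?_)⟩ <;> simp)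
    (by
      intro y hy
      have by1 := bd₂ y hy
      rintro ((hS | ⟨i, hi, hS | hS | hS | hS⟩) | hS | hS | hS | hS)
      · have b := abs_le.1 (st₂.bS _ hS)
        simp only [Prod.fst_sub, Prod.fst_add] at b
        omega
      · have := bd₂ i hi
        have b := congrArg Prod.fst hS
        simp only [Prod.fst_sub, Prod.fst_add] at b
        omega
      · have := bd₂ i hi
        have b := congrArg Prod.fst hS
        simp only [Prod.fst_sub, Prod.fst_add, Prod.fst_neg] at b
        omega
      · have := ran₂ i hi
        have := ran₂ y hy
        have b := congrArg Prod.fst hS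
        simp only [Prod.fst_sub, Prod.fst_add] at b
        omega
      · have := bd₂ i hi
        have b := congrArg Prod.fst hS
        simp only [Prod.fst_sub, Prod.fst_add, Prod.fst_neg] at b
        omega
      all_goals
        have b := congrArg Prod.fst hS
        simp only [Prod.fst_sub, Prod.fst_add, Prod.fst_neg] at b
        omega)
    (fun y hy z hz => fst_ne (by
      have := bd₂ y hy
      have := bd₂ z hz
      simp only [Prod.fst_sub, Prod.fst_add, Prod.fst_neg]
      omega))
    (fun y hy z hz => fst_ne (by
      have := bd₂ y hy
      have := bd₂ z hz
      simp only [Prod.fst_sub, Prod.fst_add]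
      omega))
    (fun y hy z hz => fst_ne (by
      have := bd₂ y hy
      have := bd₂ z hz
      simp only [Prod.fst_sub, Prod.fst_add, Prod.fst_neg]
      omega))
  refine ⟨_, _, f₅, ρ₅, |M₃| + 10 * w.1, (sub₂.trans (Finset.subset_insert _ _)).trans s34,
    ⟨?_, ?_, inj_insert hx' st₃.injL, inj_insert' hw' st₃.injR, g₅⟩, (e03.trans e₄).trans e₅, ?_⟩
  · have l6 := le_abs_self M₃
    have l7 := abs_nonneg M₃
    rintro u ((hS | hS) | ⟨i, hi, hS⟩)
    · have := st₃.bS u hS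
      omega
    · rw [abs_le]
      rcases hS with rfl | rfl | rfl | rfl <;> simp only [Prod.fst_neg] <;> omega
    · have := bd₂ i hi
      rw [abs_le]
      rcases hS with rfl | rfl | rfl | rfl <;>
        simp only [Prod.fst_sub, Prod.fst_add, Prod.fst_neg] <;> omega
  · have l6 := le_abs_self M₃
    have l7 := abs_nonneg M₃
    intro p hp
    rcases Finset.mem_insert.1 hp with rfl | hp
    · rw [abs_le, abs_le]
      simp only [Prod.fst_add]
      omega
    · have := st₃.bD p hp
      omega
  · have hs := g₅.sat γ v ((τ w)⁻¹ * δ * τ x) ⟨_, mA, _, mB, fun e => hγ (by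
      simpa using congrArg Prod.fst e), by simp⟩
    rw [hs.1]
    exact (((e₄.trans e₅)) v hρv₃).1

/-- bundled stages -/
structure St (τ : C → K) (δ : K) where
  D : Finset (C × C)
  S : Set C
  f : C → K
  ρ : C → C
  M : ℤ
  st : Stage τ δ D S f ρ M

instance (τ : C → K) (δ : K) : Preorder (St τ δ) where
  le s s' := s.D ⊆ s'.D ∧ Ext s.f s.ρ s'.f s'.ρ
  le_refl s := ⟨subset_rfl, Ext.refl _ _⟩
  le_trans _ _ _ h h' := ⟨h.1.trans h'.1, h.2.trans h'.2⟩

def St.init (τ : C → K) (δ : K) : St τ δ where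
  D := ∅
  S := ∅
  f := fun _ => 1
  ρ := id
  M := 0
  st := by
    refine ⟨by simp, by simp, by simp, by simp, ?_⟩
    refine ⟨by simp, by simp, ?_, by simp, by simp, by simp, fun v => (Conn.equiv _).refl v⟩
    rintro a b k ⟨p, hp, _⟩
    simp at hp

def cofL (τ : C → K) (δ : K) (x : C) : Order.Cofinal (St τ δ) where
  carrier := {s | ∃ y, (x, y) ∈ s.D}
  isCofinal := by
    intro s
    by_cases hx : ∃ y, (x, y) ∈ s.D
    · exact ⟨s, hx, le_refl s⟩
    · obtain ⟨w, f', ρ', M', _, st, e⟩ := extL s.st x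
        (fun p hp e => hx ⟨p.2, by rw [← e]; exact hp⟩) 0
      exact ⟨⟨_, _, _, _, _, st⟩, ⟨w, Finset.mem_insert_self _ _⟩,
        ⟨Finset.subset_insert _ _, e⟩⟩

def cofR (τ : C → K) (δ : K) (y : C) : Order.Cofinal (St τ δ) where
  carrier := {s | ∃ x, (x, y) ∈ s.D}
  isCofinal := by
    intro s
    by_cases hx : ∃ x, (x, y) ∈ s.D
    · exact ⟨s, hx, le_refl s⟩
    · obtain ⟨x, S', f', ρ', M', _, st, e⟩ := extR s.st y
        (fun p hp e => hx ⟨p.1, by rw [← e]; exact hp⟩) 0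
      exact ⟨⟨_, _, _, _, _, st⟩, ⟨x, Finset.mem_insert_self _ _⟩,
        ⟨Finset.subset_insert _ _, e⟩⟩

def cofC (τ : C → K) (δ : K) (γ : C) : Order.Cofinal (St τ δ) where
  carrier := {s | γ ≠ 0 → s.ρ γ = tt}
  isCofinal := by
    intro s
    by_cases hγ : γ = 0
    · exact ⟨s, fun h => absurd hγ h, le_refl s⟩
    · obtain ⟨D', S', f', ρ', M', hD, st, e, hc⟩ := extC s.st γ hγ
      exact ⟨⟨_, _, _, _, _, st⟩, fun _ => hc, ⟨hD, e⟩⟩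

/-- The limit object. -/
lemma limit (τ : C → K) (δ : K) : ∃ (d : Equiv.Perm C) (f : C → K),
    (∀ x y, x ≠ y → τ (d x) * f (d y - d x) = δ * (τ x * f (y - x))) ∧
    (∀ γ, γ ≠ 0 → Relation.EqvGen
      (fun a b => ∃ x y, a = y - x ∧ b = d y - d x) γ tt) := by
  classical
  let cof : (C ⊕ C ⊕ C) → Order.Cofinal (St τ δ) :=
    Sum.elim (cofL τ δ) (Sum.elim (cofR τ δ) (cofC τ δ))
  letI : Encodable (C ⊕ C ⊕ C) := Encodable.ofCountable _
  let I := Order.idealOfCofinals (St.init τ δ) cof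
  have hL : ∀ x, ∃ y, ∃ s ∈ I, (x, y) ∈ s.D := fun x => by
    obtain ⟨s, ⟨y, hy⟩, hs⟩ := Order.cofinal_meets_idealOfCofinals (St.init τ δ) cof (Sum.inl x)
    exact ⟨y, s, hs, hy⟩
  have hR : ∀ y, ∃ x, ∃ s ∈ I, (x, y) ∈ s.D := fun y => by
    obtain ⟨s, ⟨x, hx⟩, hs⟩ := Order.cofinal_meets_idealOfCofinals (St.init τ δ) cof
      (Sum.inr (Sum.inl y))
    exact ⟨x, s, hs, hx⟩
  have hC : ∀ γ, ∃ s ∈ I, γ ≠ 0 → s.ρ γ = tt := fun γ => by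
    obtain ⟨s, hx, hs⟩ := Order.cofinal_meets_idealOfCofinals (St.init τ δ) cof
      (Sum.inr (Sum.inr γ))
    exact ⟨s, hs, hx⟩
  have dir : ∀ s ∈ I, ∀ s' ∈ I, ∃ u ∈ I, s ≤ u ∧ s' ≤ u := fun s hs s' hs' =>
    I.directed s hs s' hs'
  choose d sd hdI hd using hL
  choose e se heI he using hR
  choose sc hcI hc using hC
  have de : ∀ y, d (e y) = y := by
    intro y
    obtain ⟨u, _, h1, h2⟩ := dir _ (heI y) _ (hdI (e y))
    exact congrArg Prod.snd (u.st.injL _ (h2.1 (hd (e y))) _ (h1.1 (he y)) rfl)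
  have ed : ∀ x, e (d x) = x := by
    intro x
    obtain ⟨u, _, h1, h2⟩ := dir _ (heI (d x)) _ (hdI x)
    exact congrArg Prod.fst (u.st.injR _ (h1.1 (he (d x))) _ (h2.1 (hd x)) rfl)
  have dmem : ∀ u ∈ I, ∀ p ∈ u.D, p.2 = d p.1 := by
    intro u hu p hp
    obtain ⟨v, _, h1, h2⟩ := dir _ hu _ (hdI p.1)
    exact congrArg Prod.snd (v.st.injL _ (h1.1 hp) _ (h2.1 (hd p.1)) rfl)
  refine ⟨⟨d, e, ed, de⟩, fun v => (sc v).f v, ?_, ?_⟩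
  · intro x y hxy
    simp only [Equiv.coe_fn_mk]
    have hxy' : d x ≠ d y := fun h => hxy (by rw [← ed x, h, ed])
    obtain ⟨u₁, hu₁, a1, a2⟩ := dir _ (hdI x) _ (hdI y)
    obtain ⟨u₂, hu₂, a3, a4⟩ := dir _ (hcI (y - x)) _ (hcI (d y - d x))
    obtain ⟨u, hu, a5, a6⟩ := dir _ hu₁ _ hu₂
    have hs := u.st.good.sat (y - x) (d y - d x) ((τ (d x))⁻¹ * δ * τ x)
      ⟨(x, d x), (a1.trans a5).1 (hd x), (y, d y), (a2.trans a5).1 (hd y),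
        fun h => hxy (congrArg Prod.fst h), rfl⟩
    have q1 := ((a3.trans a6).2 (y - x) (hc _ (sub_ne_zero.2 hxy.symm))).2
    have q2 := ((a4.trans a6).2 (d y - d x) (hc _ (sub_ne_zero.2 hxy'.symm))).2
    rw [← q1, ← q2, hs.2]
    group
  · intro γ hγ
    have hs := (sc γ).st.good.sound γ
    rw [hc γ hγ] at hs
    refine Relation.EqvGen.mono ?_ _ _ hs
    rintro a b ⟨p, hp, q, hq, rfl, rfl⟩
    exact ⟨p.1, q.1, rfl, by
      simp only [Equiv.coe_fn_mk]
      rw [dmem _ (hcI γ) p hp, dmem _ (hcI γ) q hq]⟩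

end stage

/-- the free product of `ℤ × ℤ/2` and `ℤ` -/
abbrev KK : Type := Monoid.Coprod (Multiplicative C) (Multiplicative ℤ)

def tau (x : C) : KK := Monoid.Coprod.inl (Multiplicative.ofAdd x)

def del : KK := Monoid.Coprod.inr (Multiplicative.ofAdd 1)

def actHom (d : Equiv.Perm C) : KK →* Equiv.Perm C :=
  Monoid.Coprod.lift (MulAction.toPermHom (Multiplicative C) C) (zpowersHom _ d)

lemma actHom_tau (d : Equiv.Perm C) (x y : C) : actHom d (tau x) y = x + y := by
  simp [actHom, tau, Monoid.Coprod.lift_apply_inl]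

lemma actHom_del (d : Equiv.Perm C) : actHom d del = d := by
  simp [actHom, del, Monoid.Coprod.lift_apply_inr]

lemma tau_add (x y : C) : tau (x + y) = tau x * tau y := by
  simp [tau, ofAdd_add]

lemma tau_zero : tau 0 = 1 := by
  simp [tau]

lemma tau_neg (x : C) : tau (-x) = (tau x)⁻¹ := by
  simp [tau, ofAdd_neg]

lemma tau_zsmul (n : ℤ) (x : C) : tau (n • x) = tau x ^ n := by
  rw [tau, ofAdd_zsmul, map_zpow, tau]

lemma closure_gen : Subgroup.closure ({tau (1, 0), tau (0, 1), del} : Set KK) = ⊤ := by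
  rw [eq_top_iff]
  have h1 : tau (1, 0) ∈ Subgroup.closure ({tau (1, 0), tau (0, 1), del} : Set KK) :=
    Subgroup.subset_closure (by simp)
  have h2 : tau (0, 1) ∈ Subgroup.closure ({tau (1, 0), tau (0, 1), del} : Set KK) :=
    Subgroup.subset_closure (by simp)
  have h3 : del ∈ Subgroup.closure ({tau (1, 0), tau (0, 1), del} : Set KK) :=
    Subgroup.subset_closure (by simp)
  intro k _
  induction k using Monoid.Coprod.induction_on with
  | inl m =>
    obtain ⟨x, rfl⟩ := Multiplicative.ofAdd.surjective m
    obtain ⟨n, e⟩ := x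
    have hx : ((n, e) : C) = n • ((1, 0) : C) + (0, e) := by
      ext <;> simp
    change tau (n, e) ∈ _
    rw [hx, tau_add, tau_zsmul]
    refine mul_mem (zpow_mem h1 n) ?_
    fin_cases e
    · change tau 0 ∈ _
      rw [tau_zero]; exact one_mem _
    · exact h2
  | inr n =>
    obtain ⟨n, rfl⟩ := Multiplicative.ofAdd.surjective n
    have : (Monoid.Coprod.inr (Multiplicative.ofAdd n) : KK) = del ^ n := by
      rw [del, ← map_zpow, ← ofAdd_zsmul]; simp
    rw [this]
    exact zpow_mem h3 n
  | mul x y hx hy => exact mul_mem (hx trivial) (hy trivial)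

lemma equivariant (d : Equiv.Perm C) (f : C → KK)
    (h : ∀ x y, x ≠ y → tau (d x) * f (d y - d x) = del * (tau x * f (y - x))) (k : KK) :
    ∀ x y, x ≠ y → tau (actHom d k x) * f (actHom d k y - actHom d k x)
      = k * (tau x * f (y - x)) := by
  have hk : k ∈ Subgroup.closure ({tau (1, 0), tau (0, 1), del} : Set KK) := by
    rw [closure_gen]; trivial
  have ht : ∀ c x y, x ≠ y → tau (actHom d (tau c) x) * f (actHom d (tau c) y - actHom d (tau c) x)
      = tau c * (tau x * f (y - x)) := by
    intro c x y _
    rw [actHom_tau, actHom_tau, add_sub_add_left_eq_sub, tau_add, mul_assoc]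
  induction hk using Subgroup.closure_induction with
  | mem g hg =>
    rcases hg with rfl | rfl | rfl
    · exact ht _
    · exact ht _
    · rw [actHom_del]; exact h
  | one => intro x y _; simp
  | mul a b _ _ ha hb =>
    intro x y hxy
    rw [map_mul, Equiv.Perm.mul_apply, Equiv.Perm.mul_apply,
      ha _ _ (fun e => hxy ((actHom d b).injective e)), hb _ _ hxy, mul_assoc]
  | inv a _ ha =>
    intro x y hxy
    have := ha ((actHom d a)⁻¹ x) ((actHom d a)⁻¹ y)
      (fun e => hxy ((actHom d a)⁻¹.injective e))
    have hi : ∀ z, actHom d a ((actHom d a)⁻¹ z) = z := fun z =>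
      (actHom d a).apply_symm_apply z
    rw [hi, hi] at this
    rw [map_inv, this, inv_mul_cancel_left]

lemma connect (d : Equiv.Perm C) (a b : C)
    (h : Relation.EqvGen (fun a b => ∃ x y, a = y - x ∧ b = d y - d x) a b) :
    ∀ x y, ∃ k, actHom d k x = y ∧ actHom d k (x + a) = y + b := by
  induction h with
  | rel a b h =>
    obtain ⟨p, q, rfl, rfl⟩ := h
    intro x y
    refine ⟨tau (y - d p) * del * tau (p - x), ?_, ?_⟩
    · simp only [map_mul, Equiv.Perm.mul_apply, actHom_tau, actHom_del]
      rw [sub_add_cancel, sub_add_cancel]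
    · simp only [map_mul, Equiv.Perm.mul_apply, actHom_tau, actHom_del]
      rw [show p - x + (x + (q - p)) = q by abel]
      abel
  | refl a =>
    intro x y
    refine ⟨tau (y - x), ?_, ?_⟩ <;> rw [actHom_tau] <;> abel
  | symm a b _ ih =>
    intro x y
    obtain ⟨k, h1, h2⟩ := ih y x
    refine ⟨k⁻¹, ?_, ?_⟩
    · rw [map_inv, Equiv.Perm.inv_eq_iff_eq, h1]
    · rw [map_inv, Equiv.Perm.inv_eq_iff_eq, h2]
  | trans a b c _ _ ih1 ih2 =>
    intro x y
    obtain ⟨k, h1, h2⟩ := ih1 x x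
    obtain ⟨l, h3, h4⟩ := ih2 x y
    refine ⟨l * k, ?_, ?_⟩
    · rw [map_mul, Equiv.Perm.mul_apply, h1, h3]
    · rw [map_mul, Equiv.Perm.mul_apply, h2, h4]

lemma infinite_KK : Infinite KK := by
  refine Infinite.of_injective (fun n : ℤ => tau (n, 0)) ?_
  intro m n h
  have h' : Multiplicative.ofAdd ((m, 0) : C) = Multiplicative.ofAdd (n, 0) :=
    Monoid.Coprod.inl_injective h
  exact congrArg Prod.fst (Multiplicative.ofAdd.injective h')

lemma fg_KK : Group.FG KK :=
  Group.fg_iff.2 ⟨_, closure_gen, by simp⟩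

lemma sharp (d : Equiv.Perm C) (f : C → KK)
    (h : ∀ x y, x ≠ y → tau (d x) * f (d y - d x) = del * (tau x * f (y - x)))
    (hc : ∀ γ, γ ≠ 0 → Relation.EqvGen (fun a b => ∃ x y, a = y - x ∧ b = d y - d x) γ tt)
    (x₁ x₂ y₁ y₂ : C) (hx : x₁ ≠ x₂) (hy : y₁ ≠ y₂) :
    ∃! k : KK, actHom d k x₁ = y₁ ∧ actHom d k x₂ = y₂ := by
  obtain ⟨k, h1, h2⟩ := connect d _ _ ((hc _ (sub_ne_zero.2 hx.symm)).trans _ _ _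
    (hc _ (sub_ne_zero.2 hy.symm)).symm) x₁ y₁
  rw [add_sub_cancel, add_sub_cancel] at h2
  refine ⟨k, ⟨h1, h2⟩, ?_⟩
  rintro l ⟨h3, h4⟩
  have e1 := equivariant d f h k _ _ hx
  have e2 := equivariant d f h l _ _ hx
  rw [h1, h2] at e1
  rw [h3, h4] at e2
  exact mul_right_cancel (e2.symm.trans e1)

end SharpTwo

/-- There exists an infinite, finitely generated group `G` that acts sharply 2-transitively
on some set `X`. -/
theorem stmt_0 :
    ∃ (G : Type) (_ : Group G), Infinite G ∧ Group.FG G ∧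
      ∃ (X : Type) (_ : MulAction G X), SharplyTwoTransitive G X := by
  obtain ⟨d, f, h, hc⟩ := SharpTwo.limit SharpTwo.tau SharpTwo.del
  refine ⟨SharpTwo.KK, inferInstance, SharpTwo.infinite_KK, SharpTwo.fg_KK, SharpTwo.C,
    MulAction.compHom SharpTwo.C (SharpTwo.actHom d), ?_⟩
  exact ⟨inferInstance, SharpTwo.sharp d f h hc⟩
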